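/- Let Ω ⊆ ℝⁿ be open, n ≥ 2, and let u : Ω → ℝ be a smooth function with |Du(x)| < 1 for all x ∈ Ω. Fix x ∈ Ω with Du(x) ≠ 0 and suppose div(Du/√(1+|Du|²))(x) = div(Du/√(1−|Du|²))(x) (the graph has the same mean curvature at that point in ℝ^{n+1} and in 𝕃^{n+1}). Write g = |Du(x)|², L = Δu(x), P = D²u(x)(Du(x),Du(x)) and A = √((1−g)/(1+g)). Then P/(g(1−g)^{3/2}) = −(L − P/g)/((A² + A + 1)√(1−g)). Equivalently, in terms of the Lorentzian normal curvatures of the graph: −κ^L_{α'} = (κ^L_{(e_1,0)} + … + κ^L_{(e_{n−1},0)})/(A² + A + 1), where e_1,…,e_{n−1} is an orthonormal basis of the orthogonal complement of Du(x) and α' is the lift of the gradient direction. -/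

import Mathlib

open scoped RealInnerProductSpace

/-- Divergence of a vector field on ℝⁿ. -/
noncomputable def vdiv {n : ℕ} (X : EuclideanSpace ℝ (Fin n) → EuclideanSpace ℝ (Fin n))
    (x : EuclideanSpace ℝ (Fin n)) : ℝ :=
  ∑ i, ⟪fderiv ℝ X x (EuclideanSpace.single i 1), EuclideanSpace.single i 1⟫

/-- Hessian bilinear form `D²u(x)(v,w)` of a function on ℝⁿ. -/
noncomputable def hess {n : ℕ} (u : EuclideanSpace ℝ (Fin n) → ℝ)
    (x v w : EuclideanSpace ℝ (Fin n)) : ℝ :=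
  ⟪fderiv ℝ (gradient u) x v, w⟫

/-- The Lorentz–Minkowski inner product on ℝⁿ × ℝ = 𝕃^{n+1}. -/
noncomputable def linner {n : ℕ} (p q : EuclideanSpace ℝ (Fin n) × ℝ) : ℝ :=
  ⟪p.1, q.1⟫ - p.2 * q.2

/-- Leibniz rule for the divergence of a scalar multiple of a vector field. -/
theorem vdiv_smul {n : ℕ} {φ : EuclideanSpace ℝ (Fin n) → ℝ}
    {X : EuclideanSpace ℝ (Fin n) → EuclideanSpace ℝ (Fin n)} {x : EuclideanSpace ℝ (Fin n)}
    (hφ : DifferentiableAt ℝ φ x) (hX : DifferentiableAt ℝ X x) :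
    vdiv (fun y => φ y • X y) x = φ x * vdiv X x + fderiv ℝ φ x (X x) := by
  have hsum : X x = ∑ i, X x i • EuclideanSpace.single i (1 : ℝ) := by
    simpa using ((EuclideanSpace.basisFun (Fin n) ℝ).sum_repr (X x)).symm
  have hφX : fderiv ℝ φ x (X x) = ∑ i, X x i * fderiv ℝ φ x (EuclideanSpace.single i 1) := by
    conv_lhs => rw [hsum]
    simp
  unfold vdiv
  rw [hφX, Finset.mul_sum, ← Finset.sum_add_distrib]
  refine Finset.sum_congr rfl fun i _ => ?_
  rw [fderiv_fun_smul hφ hX]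
  simp [inner_add_left, inner_smul_left, EuclideanSpace.inner_single_right]
  ring

theorem hasFDerivAt_inv_sqrt_one_add_mul_norm_sq {E F : Type*} [NormedAddCommGroup E]
    [NormedSpace ℝ E] [NormedAddCommGroup F] [InnerProductSpace ℝ F] {X : E → F} {x : E}
    (hX : DifferentiableAt ℝ X x) (c : ℝ) (hc : 0 < 1 + c * ‖X x‖ ^ 2) :
    HasFDerivAt (fun y => (Real.sqrt (1 + c * ‖X y‖ ^ 2))⁻¹)
      ((-c / Real.sqrt (1 + c * ‖X x‖ ^ 2) ^ 3) • (innerSL ℝ (X x)).comp (fderiv ℝ X x)) x := by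
  have h0 : HasFDerivAt (fun y => 1 + c * ‖X y‖ ^ 2)
      (c • ((2 : ℝ) • (innerSL ℝ (X x)).comp (fderiv ℝ X x))) x := by
    simpa [ofNat_smul_eq_nsmul] using (hX.hasFDerivAt.norm_sq.const_mul c).const_add 1
  have hs := Real.sqrt_pos.2 hc
  have h1 := (hasDerivAt_inv hs.ne').comp_hasFDerivAt x (h0.sqrt hc.ne')
  refine h1.congr_fderiv ?_
  ext v
  simp
  field_simp

/-- Divergence of the normalised field `X / √(1 + c|X|²)`. -/
theorem vdiv_inv_sqrt_smul {n : ℕ}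
    {X : EuclideanSpace ℝ (Fin n) → EuclideanSpace ℝ (Fin n)} {x : EuclideanSpace ℝ (Fin n)}
    (hX : DifferentiableAt ℝ X x) (c : ℝ) (hc : 0 < 1 + c * ‖X x‖ ^ 2) :
    vdiv (fun y => (Real.sqrt (1 + c * ‖X y‖ ^ 2))⁻¹ • X y) x =
      vdiv X x / Real.sqrt (1 + c * ‖X x‖ ^ 2) -
        c * ⟪fderiv ℝ X x (X x), X x⟫ / Real.sqrt (1 + c * ‖X x‖ ^ 2) ^ 3 := by
  have h := hasFDerivAt_inv_sqrt_one_add_mul_norm_sq hX c hc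
  rw [vdiv_smul h.differentiableAt hX, h.fderiv]
  simp [real_inner_comm]
  ring

theorem ContDiffAt.differentiableAt_gradient {F : Type*} [NormedAddCommGroup F]
    [InnerProductSpace ℝ F] [CompleteSpace F] {u : F → ℝ} {x : F} (hu : ContDiffAt ℝ 2 u x) :
    DifferentiableAt ℝ (gradient u) x := by
  have h : DifferentiableAt ℝ (fderiv ℝ u) x :=
    (hu.fderiv_right (m := 1) (by norm_num)).differentiableAt (by norm_num)
  exact (InnerProductSpace.toDual ℝ F).symm.toContinuousLinearEquiv.differentiableAt.comp x h

/-- At a point where the graph of u has the same mean curvature in ℝ^{n+1} and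
𝕃^{n+1} and the gradient does not vanish, the Lorentzian normal curvature along
the lifted gradient is -1/(A²+A+1) times the sum of the Lorentzian normal
curvatures along level directions. -/
theorem gradient_curvature_relation {n : ℕ} (hn : 2 ≤ n)
    (Ω : Set (EuclideanSpace ℝ (Fin n))) (hΩ : IsOpen Ω)
    (u : EuclideanSpace ℝ (Fin n) → ℝ) (hu : ContDiffOn ℝ (⊤ : ℕ∞) u Ω)
    (hsp : ∀ x ∈ Ω, ‖gradient u x‖ < 1)
    (x : EuclideanSpace ℝ (Fin n)) (hx : x ∈ Ω) (hx0 : gradient u x ≠ 0)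
    (heq : vdiv (fun y => (Real.sqrt (1 + ‖gradient u y‖ ^ 2))⁻¹ • gradient u y) x =
      vdiv (fun y => (Real.sqrt (1 - ‖gradient u y‖ ^ 2))⁻¹ • gradient u y) x)
    (g L P A : ℝ) (hg : g = ‖gradient u x‖ ^ 2)
    (hL : L = vdiv (gradient u) x)
    (hP : P = hess u x (gradient u x) (gradient u x))
    (hA : A = Real.sqrt ((1 - g) / (1 + g))) :
    P / (g * Real.sqrt (1 - g) ^ 3) =
      -((L - P / g) / ((A ^ 2 + A + 1) * Real.sqrt (1 - g))) := by
  have hD : DifferentiableAt ℝ (gradient u) x :=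
    ((hu.contDiffAt (hΩ.mem_nhds hx)).of_le (WithTop.coe_le_coe.2 le_top)).differentiableAt_gradient
  have hgpos : 0 < g := hg ▸ pow_pos (norm_pos_iff.2 hx0) 2
  have hg1 : g < 1 := hg ▸ pow_lt_one₀ (norm_nonneg _) (hsp x hx) two_ne_zero
  have hR := vdiv_inv_sqrt_smul hD 1 (by rw [← hg]; linarith)
  have hM := vdiv_inv_sqrt_smul hD (-1) (by rw [← hg]; linarith)
  simp only [one_mul, neg_mul, ← sub_eq_add_neg] at hR hM
  rw [hR, hM, ← hg, ← hL] at heq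
  change L / √(1 + g) - hess u x (gradient u x) (gradient u x) / √(1 + g) ^ 3 =
    L / √(1 - g) - -hess u x (gradient u x) (gradient u x) / √(1 - g) ^ 3 at heq
  rw [← hP] at heq
  rw [Real.sqrt_div (by linarith)] at hA
  have ha : 0 < √(1 + g) := Real.sqrt_pos.2 (by linarith)
  have hb : 0 < √(1 - g) := Real.sqrt_pos.2 (by linarith)
  have ha2 : √(1 + g) ^ 2 = 1 + g := Real.sq_sqrt (by linarith)
  have hb2 : √(1 - g) ^ 2 = 1 - g := Real.sq_sqrt (by linarith)
  generalize √(1 + g) = a at *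
  generalize √(1 - g) = b at *
  have key : L * a ^ 2 * b ^ 2 * (b - a) = P * (a ^ 3 + b ^ 3) := by
    field_simp at heq
    linear_combination heq
  have key2 : g * L * a ^ 2 * b ^ 2 = P * (a ^ 2 * b ^ 2 - a ^ 2 - a * b - b ^ 2) := by
    have hg' : g = (a ^ 2 - b ^ 2) / 2 := by linarith
    have h2 : a ^ 2 + b ^ 2 = 2 := by linarith
    rw [hg']
    linear_combination (-(a + b) / 2) * key - P / 2 * (a ^ 2 + a * b + b ^ 2) * h2
  have hA' : A ^ 2 + A + 1 = (a ^ 2 + a * b + b ^ 2) / a ^ 2 := by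
    rw [hA]; field_simp; ring
  have hpos : 0 < a ^ 2 + a * b + b ^ 2 := by positivity
  rw [hA']
  field_simp
  linear_combination key2
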